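/- Let G be a simple graph in which every vertex has degree at most 4 and v a vertex of G of degree at most 3. Suppose the edges of G are colored greedily, in an order in which every edge at larger distance from v precedes every edge at smaller distance from v, assigning to each edge the least color not forbidden by previously colored edges at distance at most 1 from it. Then every edge, at the moment it is colored, has at most 20 previously colored edges in its neighborhood; consequently the greedy coloring is a strong edge-coloring with at most 21 colors. -/

import Mathlib

/-- Two edges of `G` conflict in a strong edge-coloring: they share an endpoint,
or some endpoint of one is adjacent in `G` to some endpoint of the other.
Equivalently, they are at distance at most 1 in the line graph. -/
def StrongConflict {V : Type*} (G : SimpleGraph V) (e f : Sym2 V) : Prop :=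
  (∃ v, v ∈ e ∧ v ∈ f) ∨ (∃ u v, u ∈ e ∧ v ∈ f ∧ G.Adj u v)

/-- The distance from an edge to a vertex `v`: the minimum over the two
endpoints of the edge of the graph distance to `v`. -/
noncomputable def edgeVertexDist {V : Type*} (G : SimpleGraph V) (v : V)
    (e : Sym2 V) : ℕ :=
  Sym2.lift ⟨fun a b => min (G.dist v a) (G.dist v b),
    fun a b => by simp [min_comm]⟩ e

theorem StrongConflict.symm {V : Type*} {G : SimpleGraph V} {e f : Sym2 V}
    (h : StrongConflict G e f) : StrongConflict G f e := by
  rcases h with ⟨v, he, hf⟩ | ⟨u, v, hu, hv, huv⟩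
  · exact Or.inl ⟨v, hf, he⟩
  · exact Or.inr ⟨v, u, hv, hu, huv.symm⟩

theorem edgeVertexDist_mk {V : Type*} (G : SimpleGraph V) (v a b : V) :
    edgeVertexDist G v s(a, b) = min (G.dist v a) (G.dist v b) := rfl

theorem edgeVertexDist_le_of_mem {V : Type*} (G : SimpleGraph V) (v : V) {w : V} {e : Sym2 V}
    (hw : w ∈ e) : edgeVertexDist G v e ≤ G.dist v w := by
  obtain ⟨u, rfl⟩ := hw
  exact min_le_left _ _

/-- Every edge has an endpoint realizing its distance to `v`. -/
theorem exists_eq_mk_edgeVertexDist_eq {V : Type*} (G : SimpleGraph V) (v : V) (e : Sym2 V) :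
    ∃ a b, e = s(a, b) ∧ edgeVertexDist G v e = G.dist v a := by
  induction e with
  | _ a b =>
    rcases le_total (G.dist v a) (G.dist v b) with h | h
    · exact ⟨a, b, rfl, min_eq_left h⟩
    · exact ⟨b, a, Sym2.eq_swap, min_eq_right h⟩

theorem SimpleGraph.Connected.exists_adj_dist_lt {V : Type*} {G : SimpleGraph V}
    (hconn : G.Connected) {v a : V} (hne : a ≠ v) :
    ∃ z, G.Adj a z ∧ G.dist v z < G.dist v a := by
  obtain ⟨p, hp⟩ := hconn.exists_walk_length_eq_dist a v
  cases p with
  | nil => exact absurd rfl hne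
  | cons h q =>
    rename_i z
    refine ⟨z, h, ?_⟩
    have hq := SimpleGraph.dist_le q
    rw [SimpleGraph.Walk.length_cons] at hp
    rw [G.dist_comm (u := v) (v := z), G.dist_comm (u := v) (v := a)]
    omega

/-- An edge in conflict with `s(a, b)` and different from it has an endpoint that is a neighbor
of `a` other than `b`, or a neighbor of `b` other than `a`. -/
theorem StrongConflict.exists_mem_neighborFinset_erase {V : Type*} [Fintype V] [DecidableEq V]
    {G : SimpleGraph V} [DecidableRel G.Adj] {a b : V} {f : Sym2 V} (hf : f ∈ G.edgeSet)
    (hne : f ≠ s(a, b)) (h : StrongConflict G f s(a, b)) :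
    ∃ w ∈ f, w ∈ (G.neighborFinset a).erase b ∪ (G.neighborFinset b).erase a := by
  have key : ∀ x, x ∈ f → (x = a ∨ x = b) →
      ∃ w ∈ f, w ∈ (G.neighborFinset a).erase b ∪ (G.neighborFinset b).erase a := by
    rintro x ⟨y, rfl⟩ hx
    rw [SimpleGraph.mem_edgeSet] at hf
    refine ⟨y, Sym2.mem_mk_right _ _, ?_⟩
    rcases hx with rfl | rfl
    · have hy : y ≠ b := fun h => hne (by rw [h])
      simp [hy, hf]
    · have hy : y ≠ a := fun h => hne (by rw [h, Sym2.eq_swap])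
      simp [hy, hf]
  rcases h with ⟨x, hxf, hx⟩ | ⟨u, x, hu, hx, hadj⟩
  · exact key x hxf (Sym2.mem_iff.mp hx)
  · by_cases hua : u = a ∨ u = b
    · exact key u hu hua
    · push Not at hua
      refine ⟨u, hu, ?_⟩
      rcases Sym2.mem_iff.mp hx with rfl | rfl
      · simp [hua, hadj.symm]
      · simp [hua, hadj.symm]

theorem SimpleGraph.ncard_edges_meeting_le {V : Type*} [Fintype V] [DecidableEq V]
    (G : SimpleGraph V) [DecidableRel G.Adj] {d : ℕ} (hdeg : ∀ u, G.degree u ≤ d)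
    (S : Finset V) {A : Set G.edgeSet} (hA : ∀ f ∈ A, ∃ w ∈ (f : Sym2 V), w ∈ S) :
    A.ncard ≤ S.card * d := by
  rw [← Set.ncard_image_of_injective A Subtype.val_injective]
  calc (Subtype.val '' A).ncard
      ≤ ((S.biUnion fun w => G.incidenceFinset w : Finset (Sym2 V)) : Set (Sym2 V)).ncard := by
        refine Set.ncard_le_ncard ?_ (Finset.finite_toSet _)
        rintro _ ⟨f, hf, rfl⟩
        obtain ⟨w, hwf, hwS⟩ := hA f hf
        rw [Finset.mem_coe, Finset.mem_biUnion]
        exact ⟨w, hwS, by rw [SimpleGraph.mem_incidenceFinset]; exact ⟨f.2, hwf⟩⟩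
    _ = (S.biUnion fun w => G.incidenceFinset w).card := Set.ncard_coe_finset _
    _ ≤ S.card * d := Finset.card_biUnion_le_card_mul _ _ _ fun w _ => by
        rw [SimpleGraph.card_incidenceFinset_eq_degree]
        exact hdeg w

/-- The least natural number avoiding the values of `C` on a finite set `A` is at most the size
of `A`. -/
theorem Set.Finite.le_ncard_of_isLeast_avoiding {α : Type*} {A : Set α} (hA : A.Finite)
    (C : α → ℕ) {m : ℕ} (hm : IsLeast {c : ℕ | ∀ f ∈ A, C f ≠ c} m) : m ≤ A.ncard := by
  have hsub : Set.Iio m ⊆ C '' A := by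
    intro c hc
    by_contra hcon
    exact absurd (hm.2 fun f hf hfc => hcon ⟨f, hf, hfc⟩) (not_le.mpr hc)
  calc m = (Set.Iio m).ncard := by simp [← Finset.coe_Iio, Set.ncard_coe_finset]
    _ ≤ (C '' A).ncard := Set.ncard_le_ncard hsub (hA.image C)
    _ ≤ A.ncard := Set.ncard_image_le hA

/-- Let `G` be a connected graph with maximum degree at most 4 and let `v` be a
vertex of degree at most 3.  Suppose the edges are colored greedily (each edge
gets the least color not already used on a conflicting edge colored earlier) in
an order `pos` in which edges farther from `v` come before edges nearer to `v`.
Then every edge has at most 20 previously colored edges in its neighborhood,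
the resulting coloring is a strong edge-coloring, and it uses at most the 21
colors `0, 1, …, 20`. -/
theorem greedy_strong_edge_coloring_21 {V : Type*} [Fintype V]
    (G : SimpleGraph V) [DecidableRel G.Adj] (hconn : G.Connected)
    (hdeg : ∀ u, G.degree u ≤ 4) (v : V) (hv : G.degree v ≤ 3)
    (pos : G.edgeSet → ℕ) (hposinj : Function.Injective pos)
    (hcompat : ∀ e f : G.edgeSet,
      edgeVertexDist G v (f : Sym2 V) < edgeVertexDist G v (e : Sym2 V) →
        pos e < pos f)
    (C : G.edgeSet → ℕ)
    (hgreedy : ∀ e : G.edgeSet,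
      IsLeast {c : ℕ | ∀ f : G.edgeSet, f ≠ e →
        StrongConflict G (f : Sym2 V) (e : Sym2 V) → pos f < pos e → C f ≠ c}
        (C e)) :
    (∀ e : G.edgeSet,
      {f : G.edgeSet | f ≠ e ∧ StrongConflict G (f : Sym2 V) (e : Sym2 V) ∧
        pos f < pos e}.ncard ≤ 20) ∧
    (∀ e f : G.edgeSet, e ≠ f →
      StrongConflict G (e : Sym2 V) (f : Sym2 V) → C e ≠ C f) ∧
    (∀ e : G.edgeSet, C e < 21) := by
  classical
  have hcard : ∀ e : G.edgeSet,
      {f : G.edgeSet | f ≠ e ∧ StrongConflict G (f : Sym2 V) (e : Sym2 V) ∧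
        pos f < pos e}.ncard ≤ 20 := by
    rintro ⟨e, he⟩
    obtain ⟨a, b, rfl, hdist⟩ := exists_eq_mk_edgeVertexDist_eq G v e
    have hab : G.Adj a b := he
    set T := (G.neighborFinset a).erase b ∪ (G.neighborFinset b).erase a with hT
    have hTcard : T.card + 2 ≤ G.degree a + G.degree b := by
      have hunion := Finset.card_union_le ((G.neighborFinset a).erase b)
        ((G.neighborFinset b).erase a)
      have ha := Finset.card_erase_add_one (show b ∈ G.neighborFinset a by simpa using hab)
      have hb := Finset.card_erase_add_one (show a ∈ G.neighborFinset b by simpa using hab.symm)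
      rw [← hT] at hunion
      rw [SimpleGraph.card_neighborFinset_eq_degree] at ha hb
      omega
    have ha := hdeg a
    have hb := hdeg b
    obtain ⟨S, hS, hmeet⟩ : ∃ S : Finset V, S.card ≤ 5 ∧
        ∀ f ∈ {f : G.edgeSet | f ≠ ⟨s(a, b), he⟩ ∧ StrongConflict G (f : Sym2 V) s(a, b) ∧
          pos f < pos ⟨s(a, b), he⟩}, ∃ w ∈ (f : Sym2 V), w ∈ S := by
      by_cases hav : a = v
      · subst hav
        refine ⟨T, by omega, fun f ⟨hne, hconf, _⟩ => ?_⟩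
        exact hconf.exists_mem_neighborFinset_erase f.2 fun h => hne (Subtype.ext h)
      · obtain ⟨z, haz, hz⟩ := hconn.exists_adj_dist_lt hav
        have hzb : z ≠ b := by
          rintro rfl
          have := edgeVertexDist_le_of_mem G v (Sym2.mem_mk_right a z)
          omega
        have hzT : z ∈ T := by simp [hT, hzb, haz]
        refine ⟨T.erase z, by rw [Finset.card_erase_of_mem hzT]; omega,
          fun f ⟨hne, hconf, hpos⟩ => ?_⟩
        obtain ⟨w, hwf, hwT⟩ :=
          hconf.exists_mem_neighborFinset_erase f.2 fun h => hne (Subtype.ext h)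
        refine ⟨w, hwf, Finset.mem_erase.mpr ⟨?_, hwT⟩⟩
        rintro rfl
        refine lt_asymm hpos (hcompat ⟨s(a, b), he⟩ f ?_)
        rw [hdist]
        exact (edgeVertexDist_le_of_mem G v hwf).trans_lt hz
    calc _ ≤ S.card * 4 := G.ncard_edges_meeting_le hdeg S hmeet
      _ ≤ 20 := by omega
  refine ⟨hcard, fun e f hne hconf => ?_, fun e => ?_⟩
  · rcases lt_or_gt_of_ne (hposinj.ne hne) with h | h
    · exact (hgreedy f).1 e hne hconf h
    · exact ((hgreedy e).1 f hne.symm hconf.symm h).symm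
  · refine Nat.lt_succ_of_le (le_trans ?_ (hcard e))
    refine (Set.toFinite _).le_ncard_of_isLeast_avoiding C ?_
    simpa only [Set.mem_ofPred_eq, and_imp] using hgreedy e
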